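/- Let X ≥ 1, let π₁, π₂ be probability vectors on {1,…,X} with π₂ ≥_s π₁, let c ∈ ℝ^X be nonincreasing (c(1) ≥ c(2) ≥ … ≥ c(X)), and let α ∈ (0,1] satisfy α ≥ 1 − π₁(X). Then CVaR_α(c;π₁) ≥ CVaR_α(c;π₂). -/

import Mathlib

open Finset

/-- `hfun π c α z = z + (1/α) · ∑ i, π i · max (c i − z) 0`. -/
noncomputable def hfun {X : ℕ} (π c : Fin X → ℝ) (α z : ℝ) : ℝ :=
  z + (1 / α) * ∑ i, π i * max (c i - z) 0

/-- `CVaR_α(c; π) = inf_z hfun π c α z`. -/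
noncomputable def CVaR {X : ℕ} (π c : Fin X → ℝ) (α : ℝ) : ℝ :=
  ⨅ z : ℝ, hfun π c α z

/-- Abel summation bound: if all upper tails of `d` are nonnegative and `f` is antitone and bounded
by `M`, then `∑ d i * f i` is at most `M` times the total of `d`. -/
lemma Antitone.sum_mul_le_mul_sum_of_tails_nonneg {n : ℕ} {d f : Fin n → ℝ} (hf : Antitone f)
    (hd : ∀ j, 0 ≤ ∑ i ∈ Ici j, d i) {M : ℝ} (hM : ∀ i, f i ≤ M) :
    ∑ i, d i * f i ≤ M * ∑ i, d i := by
  induction n generalizing M with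
  | zero => simp
  | succ n ih =>
    have htail : ∀ j : Fin n, 0 ≤ ∑ i ∈ Ici j, d i.succ := fun j => by
      simpa [← Fin.map_succEmb_Ici] using hd j.succ
    have hrec := ih (hf.comp_monotone (Fin.strictMono_succ).monotone) htail
      (M := f 0) (fun i => hf (Fin.zero_le _))
    have htot : 0 ≤ ∑ i, d i := by
      have h := hd 0
      rwa [show Ici (0 : Fin (n + 1)) = univ by ext i; simp] at h
    have hmul := mul_le_mul_of_nonneg_right (hM 0) htot
    rw [Fin.sum_univ_succ] at hmul htot ⊢
    rw [Fin.sum_univ_succ d]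
    simp only [Function.comp_apply] at hrec
    linarith

/-- First-order stochastic dominance decreases the expectation of an antitone function. -/
lemma Antitone.sum_mul_le_sum_mul_of_tails_le {n : ℕ} {p q f : Fin n → ℝ} (hf : Antitone f)
    (hpq : ∀ j, ∑ i ∈ Ici j, p i ≤ ∑ i ∈ Ici j, q i) (htot : ∑ i, p i = ∑ i, q i) :
    ∑ i, q i * f i ≤ ∑ i, p i * f i := by
  obtain ⟨M, hM⟩ := (Set.finite_range f).bddAbove
  have h := hf.sum_mul_le_mul_sum_of_tails_nonneg (d := fun i => q i - p i)
    (fun j => by simpa using hpq j) (fun i => hM ⟨i, rfl⟩)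
  simp only [sub_mul, sum_sub_distrib, htot, sub_self, mul_zero] at h
  linarith

/-- The expected cost is a lower bound for `hfun`. -/
lemma sum_mul_le_hfun {X : ℕ} {π : Fin X → ℝ} (h0 : ∀ i, 0 ≤ π i) (h1 : ∑ i, π i = 1)
    (c : Fin X → ℝ) {α : ℝ} (hα : α ∈ Set.Ioc (0 : ℝ) 1) (z : ℝ) :
    ∑ i, π i * c i ≤ hfun π c α z := by
  have hnonneg : 0 ≤ ∑ i, π i * max (c i - z) 0 :=
    sum_nonneg fun i _ => mul_nonneg (h0 i) (le_max_right _ _)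
  have hle : ∑ i, π i * (c i - z) ≤ ∑ i, π i * max (c i - z) 0 :=
    sum_le_sum fun i _ => mul_le_mul_of_nonneg_left (le_max_left _ _) (h0 i)
  have hinv : 1 ≤ 1 / α := (one_le_div hα.1).2 hα.2
  have hscale := le_mul_of_one_le_left hnonneg hinv
  simp only [mul_sub, sum_sub_distrib, ← sum_mul, h1, one_mul] at hle
  unfold hfun
  linarith

/-- For a nonincreasing cost vector, if `π₂ ≥_s π₁` and `α ≥ 1 − π₁(X)`, then
`CVaR_α(c; π₁) ≥ CVaR_α(c; π₂)`. -/
theorem cvar_antitone_of_fosd (X : ℕ) (hX : 1 ≤ X) (π₁ π₂ : Fin X → ℝ)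
    (h₁0 : ∀ i, 0 ≤ π₁ i) (h₁1 : ∑ i, π₁ i = 1)
    (h₂0 : ∀ i, 0 ≤ π₂ i) (h₂1 : ∑ i, π₂ i = 1)
    (hdom : ∀ j : Fin X, ∑ i ∈ Ici j, π₁ i ≤ ∑ i ∈ Ici j, π₂ i)
    (c : Fin X → ℝ) (hc : Antitone c)
    (α : ℝ) (hα : α ∈ Set.Ioc (0 : ℝ) 1)
    (hαbig : 1 - π₁ ⟨X - 1, by omega⟩ ≤ α) :
    CVaR π₂ c α ≤ CVaR π₁ c α := by
  refine ciInf_mono ⟨∑ i, π₂ i * c i, ?_⟩ fun z => ?_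
  · rintro _ ⟨z, rfl⟩
    exact sum_mul_le_hfun h₂0 h₂1 c hα z
  · have hf : Antitone fun i => max (c i - z) 0 :=
      fun i j hij => max_le_max (sub_le_sub_right (hc hij) z) le_rfl
    exact add_le_add_right (mul_le_mul_of_nonneg_left
      (hf.sum_mul_le_sum_mul_of_tails_le hdom (h₁1.trans h₂1.symm)) (one_div_pos.2 hα.1).le) z
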